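/- For every positive integer n and every integer k with 2 ≤ k ≤ n, f(n, k) ≤ 2n − k + 1; that is, every sequence in Z_n of length 2n − k + 1 in which exactly k distinct elements of Z_n occur contains a zero-sum subsequence of length n. -/

import Mathlib

open scoped Pointwise in
/-- **Scherk's theorem**: if `0 = a + b` has only the trivial solution with `a ∈ A` and `b ∈ B`,
then `|A| + |B| ≤ |A + B| + 1`. -/
theorem Finset.card_add_card_le_of_unique_zero {G : Type*} [AddCommGroup G] [DecidableEq G]
    (A B : Finset G) (hA : 0 ∈ A) (hB : 0 ∈ B)
    (h : ∀ a ∈ A, ∀ b ∈ B, a + b = 0 → b = 0) :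
    A.card + B.card ≤ (A + B).card + 1 := by
  induction hm : B.card using Nat.strong_induction_on generalizing A B with
  | _ m ih =>
  subst hm
  by_cases hex : ∃ e ∈ A, ∃ b ∈ B, e + b ∉ A
  · obtain ⟨e, he, b, hb, heb⟩ := hex
    -- the Dyson transform of `(A, B)` at `e`
    set B' := B.filter (fun x => e + x ∈ A) with hB'
    set N := B.filter (fun x => e + x ∉ A) with hN
    set A' := A ∪ N.image (fun x => e + x) with hA'
    have hBN : B'.card + N.card = B.card := Finset.card_filter_add_card_filter_not _
    have hNpos : 0 < N.card := Finset.card_pos.2 ⟨b, by simp [hN, hb, heb]⟩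
    have hA'card : A'.card = A.card + N.card := by
      rw [hA', Finset.card_union_of_disjoint,
        Finset.card_image_of_injective _ (add_right_injective e)]
      rw [Finset.disjoint_right]
      intro x hx
      obtain ⟨y, hy, rfl⟩ := Finset.mem_image.1 hx
      exact (Finset.mem_filter.1 hy).2
    have key := ih B'.card (by omega) A' B' (Finset.mem_union_left _ hA)
      (by simp [hB', hB, he]) ?_ rfl
    · have hsub : A' + B' ⊆ A + B := by
        intro z hz
        obtain ⟨a, ha, c, hc, rfl⟩ := Finset.mem_add.1 hz
        obtain ⟨hc1, hc2⟩ := Finset.mem_filter.1 hc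
        rcases Finset.mem_union.1 ha with ha | ha
        · exact Finset.add_mem_add ha hc1
        · obtain ⟨y, hy, rfl⟩ := Finset.mem_image.1 ha
          rw [show e + y + c = (e + c) + y by abel]
          exact Finset.add_mem_add hc2 (Finset.mem_filter.1 hy).1
      have := Finset.card_le_card hsub
      omega
    · intro a ha c hc hac
      obtain ⟨hc1, hc2⟩ := Finset.mem_filter.1 hc
      rcases Finset.mem_union.1 ha with ha | ha
      · exact h a ha c hc1 hac
      · obtain ⟨y, hy, rfl⟩ := Finset.mem_image.1 ha
        have hy0 : y = 0 := h (e + c) hc2 y (Finset.mem_filter.1 hy).1 (by rw [← hac]; abel)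
        subst hy0
        exact h e he c hc1 (by simpa using hac)
  · push Not at hex
    have hB1 : B = {0} := by
      refine Finset.eq_singleton_iff_unique_mem.2 ⟨hB, fun b hb => ?_⟩
      have himg : A.image (fun x => x + b) = A :=
        Finset.eq_of_subset_of_card_le
          (fun z hz => by
            obtain ⟨y, hy, rfl⟩ := Finset.mem_image.1 hz
            exact hex y hy b hb)
          (Finset.card_image_of_injective _ (add_left_injective b)).ge
      rw [← himg] at hA
      obtain ⟨a, ha, hab⟩ := Finset.mem_image.1 hA
      exact h a ha b hb hab
    simp [hB1]

namespace Multiset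

variable {G : Type*} [AddCommGroup G] [DecidableEq G]

/-- If the multiplicities in `S` are at most `h` and `S` has no nonempty zero-sum subsequence of
length at most `h`, then subsequences of length at most `h` have at least `|S| + 1` sums. -/
theorem exists_short_sums (h : ℕ) (S : Multiset G) (hS : ∀ x, S.count x ≤ h)
    (hz : ∀ U ≤ S, card U ≤ h → U.sum = 0 → U = 0) :
    ∃ C : Finset G, 0 ∈ C ∧ card S + 1 ≤ C.card ∧
      ∀ c ∈ C, ∃ U ≤ S, card U ≤ h ∧ U.sum = c := by
  open scoped Pointwise in
  induction h generalizing S with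
  | zero =>
    have hS0 : S = 0 := Multiset.ext.2 fun x => by simpa using hS x
    subst hS0
    exact ⟨{0}, by simp, by simp, fun c hc => ⟨0, by simp_all⟩⟩
  | succ h ih =>
    have hle : S.dedup ≤ S := dedup_le S
    have hcons : ∀ U ≤ S - S.dedup, ∀ a ∈ S, a ::ₘ U ≤ S := by
      intro U hU a ha
      have h1 : {a} + U ≤ S.dedup + (S - S.dedup) :=
        add_le_add (singleton_le.2 (mem_dedup.2 ha)) hU
      rwa [add_tsub_cancel_of_le hle, singleton_add] at h1
    obtain ⟨C, hC0, hCcard, hC⟩ := ih (S - S.dedup)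
      (fun x => by
        have := hS x
        rw [count_sub, count_dedup]
        split_ifs with hx
        · omega
        · rw [count_eq_zero.2 hx]; omega)
      (fun U hU hc hs => hz U (hU.trans tsub_le_self) (by omega) hs)
    have h0 : (0 : G) ∉ S := fun h0 => by
      have := hz {0} (singleton_le.2 h0) (by simp) (by simp)
      simp at this
    have hsch := Finset.card_add_card_le_of_unique_zero C (insert 0 S.toFinset) hC0 (by simp) ?_
    · refine ⟨C + insert 0 S.toFinset, ?_, ?_, ?_⟩
      · simpa using Finset.add_mem_add hC0 (Finset.mem_insert_self 0 S.toFinset)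
      · rw [Finset.card_insert_of_notMem (by simpa using h0), card_toFinset] at hsch
        have := card_sub hle
        have := card_le_card hle
        omega
      · intro c hc
        obtain ⟨d, hd, a, ha, rfl⟩ := Finset.mem_add.1 hc
        obtain ⟨U, hU, hUc, rfl⟩ := hC d hd
        rcases Finset.mem_insert.1 ha with rfl | ha
        · exact ⟨U, hU.trans tsub_le_self, by omega, by simp⟩
        · exact ⟨a ::ₘ U, hcons U hU a (mem_toFinset.1 ha), by simp [hUc],
            by simp [add_comm]⟩
    · intro c hc a ha hca
      obtain ⟨U, hU, hUc, rfl⟩ := hC c hc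
      rcases Finset.mem_insert.1 ha with rfl | ha
      · rfl
      · have := hz (a ::ₘ U) (hcons U hU a (mem_toFinset.1 ha)) (by simp [hUc])
          (by simpa [add_comm] using hca)
        simp at this

/-- A sequence of length at least `|G|` with multiplicities at most `h` has a nonempty zero-sum
subsequence of length at most `h`. -/
theorem exists_short_zero_sum [Fintype G] (h : ℕ) (S : Multiset G) (hS : ∀ x, S.count x ≤ h)
    (hcard : Fintype.card G ≤ card S) :
    ∃ U ≤ S, card U ≤ h ∧ U.sum = 0 ∧ U ≠ 0 := by
  by_contra! hcon
  obtain ⟨C, -, hC, -⟩ := exists_short_sums h S hS hcon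
  have := C.card_le_univ
  omega

/-- A zero-sum sequence with multiplicities at most `h` can be shortened, in steps of at most `h`,
to a zero-sum subsequence of length at most `|G|`. -/
theorem exists_zero_sum_card_le [Fintype G] (h : ℕ) (Q : Multiset G)
    (hQ : ∀ x, Q.count x ≤ h) (hsum : Q.sum = 0) (hcard : Fintype.card G ≤ card Q + h) :
    ∃ V ≤ Q, V.sum = 0 ∧ card V ≤ Fintype.card G ∧ Fintype.card G ≤ card V + h := by
  induction hm : card Q using Nat.strong_induction_on generalizing Q with
  | _ m ih =>
  subst hm
  by_cases hle : card Q ≤ Fintype.card G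
  · exact ⟨Q, le_rfl, hsum, hle, hcard⟩
  · obtain ⟨U, hU, hUc, hUs, hU0⟩ := exists_short_zero_sum h Q hQ (by omega)
    have hc := card_sub hU
    have hUpos := card_pos.2 hU0
    have hs : (Q - U).sum = 0 := by
      have := congrArg sum (add_tsub_cancel_of_le hU)
      rwa [sum_add, hUs, zero_add, hsum] at this
    obtain ⟨V, hV, hrest⟩ := ih (card (Q - U)) (by omega) (Q - U)
      (fun x => (count_le_of_le x tsub_le_self).trans (hQ x)) hs (by omega) rfl
    exact ⟨V, hV.trans tsub_le_self, hrest⟩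

/-- The set of sums of all (possibly empty) subsequences of `R`. -/
def subsums (R : Multiset G) : Finset G := (R.powerset.map sum).toFinset

theorem mem_subsums {R : Multiset G} {c : G} : c ∈ subsums R ↔ ∃ U ≤ R, U.sum = c := by
  simp [subsums]

theorem sum_sub_mem_subsums {R : Multiset G} {c : G} (hc : c ∈ subsums R) :
    R.sum - c ∈ subsums R := by
  obtain ⟨U, hU, rfl⟩ := mem_subsums.1 hc
  refine mem_subsums.2 ⟨R - U, tsub_le_self, ?_⟩
  rw [eq_sub_iff_add_eq, ← sum_add, tsub_add_cancel_of_le hU]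

theorem subsums_mono {R R' : Multiset G} (h : R ≤ R') : subsums R ⊆ subsums R' := fun c hc => by
  obtain ⟨U, hU, rfl⟩ := mem_subsums.1 hc
  exact mem_subsums.2 ⟨U, hU.trans h, rfl⟩

theorem neg_notMem_subsums_erase {R : Multiset G} (hR : ∀ U ≤ R, U.sum = 0 → U = 0) {x : G}
    (hx : x ∈ R) : -x ∉ subsums (R.erase x) := fun hc => by
  obtain ⟨U, hU, hs⟩ := mem_subsums.1 hc
  have := hR (x ::ₘ U) (by rw [← cons_erase hx]; exact cons_le_cons x hU) (by simp [hs])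
  simp at this

theorem sum_notMem_subsums_erase {R : Multiset G} (hR : ∀ U ≤ R, U.sum = 0 → U = 0) {x : G}
    (hx : x ∈ R) : R.sum ∉ subsums (R.erase x) := fun hc => by
  refine neg_notMem_subsums_erase hR hx ?_
  have := sum_sub_mem_subsums hc
  rwa [show (R.erase x).sum - R.sum = -x by rw [← sum_erase hx]; abel] at this

theorem sum_mem_subsums (R : Multiset G) : R.sum ∈ subsums R := mem_subsums.2 ⟨R, le_rfl, rfl⟩

theorem card_subsums_erase_lt {R : Multiset G} (hR : ∀ U ≤ R, U.sum = 0 → U = 0) {x : G}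
    (hx : x ∈ R) : (subsums (R.erase x)).card + 1 ≤ (subsums R).card :=
  Finset.card_lt_card ⟨subsums_mono (erase_le x R), fun hc =>
    sum_notMem_subsums_erase hR hx (hc (sum_mem_subsums R))⟩

/-- If deleting `x` from the sequence `R` loses only the sum of `R`, then the set of
subsequence sums is closed under subtracting `x`, except at `0`. -/
theorem sub_mem_subsums {R : Multiset G} {x : G} (hx : x ∈ R)
    (hX : ∀ c ∈ subsums R, c = R.sum ∨ c ∈ subsums (R.erase x)) {y : G} (hy : y ∈ subsums R)
    (hy0 : y ≠ 0) : y - x ∈ subsums R := by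
  rcases hX _ (sum_sub_mem_subsums hy) with h | h
  · exact absurd (by simpa using h) hy0
  · have := sum_sub_mem_subsums h
    rw [show (R.erase x).sum - (R.sum - y) = y - x by rw [← sum_erase hx]; abel] at this
    exact subsums_mono (erase_le x R) this

/-- In a zero-sum free sequence with two distinct terms, the deletion of one of the two loses at
least two subsequence sums. -/
theorem card_subsums_erase_add_two_le {R : Multiset G} (hR : ∀ U ≤ R, U.sum = 0 → U = 0) {x b : G}
    (hx : x ∈ R) (hb : b ∈ R) (hxb : x ≠ b) :
    (subsums (R.erase x)).card + 2 ≤ (subsums R).card ∨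
      (subsums (R.erase b)).card + 2 ≤ (subsums R).card := by
  by_contra! hcon
  have hX : ∀ z ∈ R, (subsums R).card < (subsums (R.erase z)).card + 2 →
      ∀ c ∈ subsums R, c = R.sum ∨ c ∈ subsums (R.erase z) := by
    intro z hz hlt c hc
    have hsub : insert R.sum (subsums (R.erase z)) ⊆ subsums R :=
      Finset.insert_subset (sum_mem_subsums R) (subsums_mono (erase_le z R))
    have heq := Finset.eq_of_subset_of_card_le hsub (by
      rw [Finset.card_insert_of_notMem (sum_notMem_subsums_erase hR hz)]; omega)
    rw [← heq] at hc
    exact Finset.mem_insert.1 hc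
  have hself : ∀ z ∈ R, z ∈ subsums R ∧ z ≠ 0 := fun z hz =>
    ⟨mem_subsums.2 ⟨{z}, singleton_le.2 hz, by simp⟩, fun h0 => by
      have := hR {z} (singleton_le.2 hz) (by simp [h0])
      simp at this⟩
  have hneg : ∀ z ∈ R, ∀ w ∈ R, z ≠ w →
      (subsums R).card < (subsums (R.erase z)).card + 2 →
      (subsums R).card < (subsums (R.erase w)).card + 2 → -z = R.sum := by
    intro z hz w hw hzw h1 h2
    have hwz := sub_mem_subsums hz (hX z hz h1) (hself w hw).1 (hself w hw).2
    have hmem := sub_mem_subsums hw (hX w hw h2) hwz (sub_ne_zero.2 hzw.symm)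
    rw [show w - z - w = -z by abel] at hmem
    exact (hX z hz h1 _ hmem).resolve_right (neg_notMem_subsums_erase hR hz)
  have e1 := hneg x hx b hb hxb hcon.1 hcon.2
  have e2 := hneg b hb x hx hxb.symm hcon.2 hcon.1
  exact hxb (neg_injective (e1.trans e2.symm))

/-- A zero-sum free sequence `R` with `t` distinct terms has at least `|R| + t` subsequence sums,
counting the empty one. -/
theorem card_add_card_toFinset_le_card_subsums (R : Multiset G)
    (hR : ∀ U ≤ R, U.sum = 0 → U = 0) :
    card R + R.toFinset.card ≤ (subsums R).card := by
  induction hm : card R using Nat.strong_induction_on generalizing R with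
  | _ m ih =>
  subst hm
  have step : ∀ x ∈ R, card R + R.toFinset.card ≤ (subsums (R.erase x)).card + 2 := by
    intro x hx
    have hc := card_erase_add_one hx
    have := ih (card (R.erase x)) (by omega) (R.erase x)
      (fun U hU => hR U (hU.trans (erase_le x R))) rfl
    have hf : R.toFinset.card ≤ (R.erase x).toFinset.card + 1 := by
      conv_lhs => rw [← cons_erase hx, toFinset_cons]
      exact Finset.card_insert_le _ _
    omega
  by_cases ht : 1 < R.toFinset.card
  · obtain ⟨x, hx, b, hb, hxb⟩ := Finset.one_lt_card.1 ht
    rw [mem_toFinset] at hx hb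
    have := step x hx
    have := step b hb
    rcases card_subsums_erase_add_two_le hR hx hb hxb with h | h <;> omega
  · rcases R.empty_or_exists_mem with rfl | ⟨x, hx⟩
    · simp
    · have h1 := card_subsums_erase_lt hR hx
      have hc := card_erase_add_one hx
      by_cases hy : x ∈ R.erase x
      · have := ih (card (R.erase x)) (by omega) (R.erase x)
          (fun U hU => hR U (hU.trans (erase_le x R))) rfl
        have : 0 < (R.erase x).toFinset.card := Finset.card_pos.2 ⟨x, by simpa using hy⟩
        omega
      · have h0 : R.erase x = 0 := by
          refine eq_zero_of_forall_notMem fun z hz => hy ?_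
          have := Finset.card_le_one.1 (not_lt.1 ht) z (mem_toFinset.2 (mem_of_mem_erase hz)) x
            (mem_toFinset.2 hx)
          exact this ▸ hz
        have : 0 < (subsums (R.erase x)).card :=
          Finset.card_pos.2 ⟨_, sum_mem_subsums _⟩
        have : card (R.erase x) = 0 := by simp [h0]
        omega

/-- Every sequence `T` of nonzero terms with `t` distinct terms has a subsequence with the same sum
and length at most `|G| - t`. -/
theorem exists_le_sum_eq_card_add_le [Fintype G] (T : Multiset G) (h0 : (0 : G) ∉ T) :
    ∃ R ≤ T, R.sum = T.sum ∧ card R + T.toFinset.card ≤ Fintype.card G := by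
  classical
  obtain ⟨R, hRmem, hmin⟩ := Finset.exists_min_image
    (T.powerset.toFinset.filter fun R => R.sum = T.sum) card ⟨T, by simp⟩
  simp only [Finset.mem_filter, mem_toFinset, mem_powerset] at hRmem hmin
  obtain ⟨hRT, hRs⟩ := hRmem
  have hsub : ∀ U ≤ R, (R - U).sum + U.sum = T.sum := fun U hU => by
    rw [← sum_add, tsub_add_cancel_of_le hU, hRs]
  have hfree : ∀ U ≤ R, U.sum = 0 → U = 0 := by
    intro U hU hs
    have := hmin (R - U) ⟨tsub_le_self.trans hRT, by simpa [hs] using hsub U hU⟩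
    rw [card_sub hU] at this
    have := card_le_card hU
    exact card_eq_zero.1 (by omega)
  have hdisj : Disjoint (subsums R) (T.toFinset \ R.toFinset) := by
    rw [Finset.disjoint_right]
    intro a ha hmem
    simp only [Finset.mem_sdiff, mem_toFinset] at ha
    obtain ⟨U, hU, hs⟩ := mem_subsums.1 hmem
    have hle : a ::ₘ (R - U) ≤ T := by
      have haR : a ∉ R - U := fun h => ha.2 (mem_of_le tsub_le_self h)
      refine le_iff_count.2 fun z => ?_
      by_cases hz : z = a
      · subst hz
        rw [count_cons_self, count_eq_zero.2 haR]
        exact one_le_count_iff_mem.2 ha.1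
      · rw [count_cons_of_ne hz]
        exact count_le_of_le z (tsub_le_self.trans hRT)
    have hm := hmin _ ⟨hle, by rw [sum_cons, ← hs, add_comm, hsub U hU]⟩
    rw [card_cons, card_sub hU] at hm
    have hUR := card_le_card hU
    rcases Nat.lt_or_ge (card U) 1 with h | h
    · have : U = 0 := card_eq_zero.1 (by omega)
      subst this
      exact h0 (by simpa [← hs] using ha.1)
    · obtain ⟨u, rfl⟩ := card_eq_one.1 (show card U = 1 by omega)
      rw [sum_singleton] at hs
      exact ha.2 (hs ▸ singleton_le.1 hU)
  refine ⟨R, hRT, hRs, ?_⟩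
  have h1 := card_add_card_toFinset_le_card_subsums R hfree
  have h2 := (subsums R ∪ (T.toFinset \ R.toFinset)).card_le_univ
  rw [Finset.card_union_of_disjoint hdisj] at h2
  have h3 := Finset.card_sdiff_add_card_eq_card (toFinset_subset.2 (subset_of_le hRT))
  omega

/-- The case in which `0` has the largest multiplicity in `S`. -/
theorem exists_zero_sum_card_eq_of_count_le [Fintype G] (S : Multiset G) (h0 : (0 : G) ∈ S)
    (hmax : ∀ x, S.count x ≤ S.count 0)
    (hcard : 2 * Fintype.card G + 1 ≤ card S + S.toFinset.card) :
    ∃ T ≤ S, card T = Fintype.card G ∧ T.sum = 0 := by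
  set T := S.filter (fun x => ¬ (0 = x)) with hT
  have hST : replicate (S.count 0) 0 + T = S := by
    rw [← filter_eq S 0, hT, filter_add_not]
  have hT0 : (0 : G) ∉ T := by simp [hT]
  have hTf : T.toFinset.card + 1 = S.toFinset.card := by
    rw [← Finset.card_erase_add_one (mem_toFinset.2 h0)]
    congr 2
    ext x
    simp only [hT, mem_toFinset, mem_filter, Finset.mem_erase]
    tauto
  have hTc : S.count 0 + card T = card S := by
    conv_rhs => rw [← hST, card_add, card_replicate]
  obtain ⟨R, hRT, hRs, hRc⟩ := exists_le_sum_eq_card_add_le T hT0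
  have hsum : (T - R).sum = 0 := by
    have := congrArg sum (tsub_add_cancel_of_le hRT)
    rwa [sum_add, hRs, add_eq_right] at this
  have hcs := card_sub hRT
  obtain ⟨V, hV, hVs, hVle, hVge⟩ := exists_zero_sum_card_le (S.count 0) (T - R)
    (fun x => (count_le_of_le x (tsub_le_self.trans (filter_le _ S))).trans (hmax x)) hsum
    (by omega)
  refine ⟨replicate (Fintype.card G - card V) 0 + V, ?_, ?_, by simp [hVs]⟩
  · rw [← hST]
    exact add_le_add ((replicate_le_replicate 0).2 (by omega)) (hV.trans tsub_le_self)
  · rw [card_add, card_replicate]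
    omega

/-- If the length of a sequence `S` in a finite abelian group `G` and its number of distinct terms
add up to more than `2|G|`, then `S` has a zero-sum subsequence of length `|G|`. -/
theorem exists_zero_sum_card_eq [Fintype G] (S : Multiset G)
    (hcard : 2 * Fintype.card G + 1 ≤ card S + S.toFinset.card) :
    ∃ T ≤ S, card T = Fintype.card G ∧ T.sum = 0 := by
  obtain ⟨g, -, hg⟩ := Finset.exists_max_image Finset.univ (fun x => S.count x)
    Finset.univ_nonempty
  have hinj : Function.Injective (fun x : G => x - g) := sub_left_injective
  have hcount : ∀ x, (S.map fun x => x - g).count x = S.count (x + g) := fun x => by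
    simpa using count_map_eq_count' (fun x : G => x - g) S hinj (x + g)
  have hgS : g ∈ S := by
    obtain ⟨a, ha⟩ : ∃ a, a ∈ S := exists_mem_of_ne_zero fun h => by simp [h] at hcard
    have := hg a (Finset.mem_univ a)
    exact one_le_count_iff_mem.1 ((one_le_count_iff_mem.2 ha).trans this)
  obtain ⟨T, hT, hTc, hTs⟩ := exists_zero_sum_card_eq_of_count_le (S.map fun x => x - g)
    (mem_map.2 ⟨g, hgS, sub_self g⟩)
    (fun x => by
      rw [hcount, hcount, zero_add]
      exact hg _ (Finset.mem_univ _))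
    (by rwa [card_map, toFinset_map, Finset.card_image_of_injective _ hinj])
  refine ⟨T.map (fun x => x + g), ?_, by simpa using hTc, ?_⟩
  · simpa using map_le_map (f := fun x => x + g) hT
  · simp [sum_map_add, hTs, hTc]

end Multiset



/-- `f(n, k) ≤ 2n - k + 1` for `2 ≤ k ≤ n`: every sequence in `ZMod n` of length
`2n - k + 1` in which exactly `k` distinct elements of `ZMod n` occur contains a zero-sum
subsequence of length `n`. -/
theorem stmt_18 (n k : ℕ) (hn : 0 < n) (hk2 : 2 ≤ k) (hk : k ≤ n)
    (S : Multiset (ZMod n)) (hcard : Multiset.card S = 2 * n - k + 1)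
    (hdist : S.toFinset.card = k) :
    ∃ T ≤ S, Multiset.card T = n ∧ T.sum = 0 := by
  have : NeZero n := ⟨hn.ne'⟩
  obtain ⟨T, hT, hTc, hTs⟩ := S.exists_zero_sum_card_eq (by rw [ZMod.card]; omega)
  exact ⟨T, hT, hTc.trans (ZMod.card n), hTs⟩
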